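/- Let P_{XY} ∈ 𝒜 = {P_{XY} : P_{X|Y}(x|y) > 0 for all (x,y)}. For any good sequence of (n,R_n) coordination codes for P_{Y|X}, it holds that lim_{n→∞} (1/n) D( P_{X^nY^n} ‖ P_{Y^n} Q_{X^n|Y^n} ) = 0, where P_{X^nY^n} is the code-induced joint distribution, P_{Y^n} is its 𝒴^n-marginal, and Q_{X^n|Y^n}(x^n|y^n) = ∏_{i=1}^n P_{X|Y}(x_i|y_i) is the backward memoryless channel. -/

import Mathlib

open scoped BigOperators ENNReal Classical
open Filter

section InformationDefs

variable {α X Y : Type*}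

/-- A probability mass function on a finite alphabet. -/
def IsPMF [Fintype α] (P : α → ℝ) : Prop :=
  (∀ a, 0 ≤ P a) ∧ ∑ a, P a = 1

/-- Variational distance `‖P − Q‖ = sup_A |P(A) − Q(A)|` on a finite alphabet. -/
noncomputable def tvDist [Fintype α] (P Q : α → ℝ) : ℝ :=
  Finset.univ.powerset.sup' ⟨∅, Finset.empty_mem_powerset _⟩
    fun A => |∑ a ∈ A, P a - ∑ a ∈ A, Q a|

/-- Relative entropy `D(P‖Q) = ∑ P log(P/Q)` on a finite alphabet, infinite when
`P` is not absolutely continuous with respect to `Q`. -/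
noncomputable def relEnt [Fintype α] (P Q : α → ℝ) : ℝ≥0∞ :=
  if ∀ a, Q a = 0 → P a = 0 then
    ENNReal.ofReal (∑ a, P a * Real.log (P a / Q a))
  else ⊤

/-- Shannon entropy on a finite alphabet. -/
noncomputable def entropy [Fintype α] (P : α → ℝ) : ℝ :=
  -∑ a, P a * Real.log (P a)

/-- First (X-) marginal of a joint distribution. -/
noncomputable def margX [Fintype Y] (P : X × Y → ℝ) : X → ℝ :=
  fun x => ∑ y, P (x, y)

/-- Second (Y-) marginal of a joint distribution. -/
noncomputable def margY [Fintype X] (P : X × Y → ℝ) : Y → ℝ :=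
  fun y => ∑ x, P (x, y)

/-- Backward conditional distribution `P_{X|Y}(x|y) = P(x,y)/P_Y(y)`. -/
noncomputable def condXY [Fintype X] (P : X × Y → ℝ) : X → Y → ℝ :=
  fun x y => P (x, y) / margY P y

/-- Forward conditional distribution `P_{Y|X}(y|x) = P(x,y)/P_X(x)`. -/
noncomputable def condYX [Fintype Y] (P : X × Y → ℝ) : Y → X → ℝ :=
  fun y x => P (x, y) / margX P x

/-- Mutual information `I(X;Y)` of a joint distribution on a finite product alphabet. -/
noncomputable def mutualInfo [Fintype X] [Fintype Y] (P : X × Y → ℝ) : ℝ :=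
  ∑ x, ∑ y, P (x, y) * Real.log (P (x, y) / (margX P x * margY P y))

/-- A block code of length `n`: an encoder into `{1,…,M}` and a decoder. -/
structure Code (X Y : Type*) (n : ℕ) where
  M : ℕ
  hM : 0 < M
  enc : (Fin n → X) → Fin M
  dec : Fin M → Fin n → Y

/-- Rate `R_n = (1/n) log M` of a code. -/
noncomputable def Code.rate {X Y : Type*} {n : ℕ} (c : Code X Y n) : ℝ :=
  Real.log c.M / n

/-- The reconstruction sequence `Yⁿ = g_n(f_n(xⁿ))` produced by a code. -/
def Code.out {X Y : Type*} {n : ℕ} (c : Code X Y n) (xs : Fin n → X) : Fin n → Y :=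
  c.dec (c.enc xs)

/-- The i.i.d. (memoryless) source distribution on `n`-blocks. -/
noncomputable def iid (PX : X → ℝ) (n : ℕ) : (Fin n → X) → ℝ :=
  fun xs => ∏ i, PX (xs i)

/-- The code-induced joint distribution
`P_{XⁿYⁿ}(xⁿ,yⁿ) = ∏ P_X(x_i) · 1{yⁿ = g_n(f_n(xⁿ))}`. -/
noncomputable def inducedJoint [DecidableEq Y] (PX : X → ℝ) {n : ℕ} (c : Code X Y n) :
    (Fin n → X) × (Fin n → Y) → ℝ :=
  fun p => (∏ i, PX (p.1 i)) * (if p.2 = c.out p.1 then 1 else 0)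

/-- The approximating joint distribution
`Q_{XⁿYⁿ}(xⁿ,yⁿ) = (|g_n⁻¹(yⁿ)|/M) · ∏ P_{X|Y}(x_i|y_i)`:
a uniformly chosen codeword passed through the backward memoryless channel. -/
noncomputable def approxJoint [Fintype X] [DecidableEq Y] (PXY : X × Y → ℝ) {n : ℕ}
    (c : Code X Y n) : (Fin n → X) × (Fin n → Y) → ℝ :=
  fun p => (((Finset.univ.filter fun m => c.dec m = p.2).card : ℝ) / c.M) *
    ∏ i, condXY PXY (p.1 i) (p.2 i)

/-- The uniform distribution over the codebook, `Q_{Yⁿ}(yⁿ) = |g_n⁻¹(yⁿ)|/M`. -/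
noncomputable def codebookUniform [DecidableEq Y] {n : ℕ} (c : Code X Y n) :
    (Fin n → Y) → ℝ :=
  fun ys => ((Finset.univ.filter fun m => c.dec m = ys).card : ℝ) / c.M

/-- The empirical (joint type) distribution of a pair of sequences. -/
noncomputable def empDist [DecidableEq X] [DecidableEq Y] {n : ℕ}
    (xs : Fin n → X) (ys : Fin n → Y) : X × Y → ℝ :=
  fun p => ((Finset.univ.filter fun i => xs i = p.1 ∧ ys i = p.2).card : ℝ) / n

/-- `‖T_{XⁿYⁿ} − P_{XY}‖ → 0` in probability under the i.i.d. source. -/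
def TVInProb [Fintype X] [Fintype Y] [DecidableEq X] [DecidableEq Y]
    (PX : X → ℝ) (PXY : X × Y → ℝ) (c : ∀ n, Code X Y n) : Prop :=
  ∀ ε : ℝ, 0 < ε →
    Tendsto (fun n => ∑ xs : Fin n → X,
        if ε < tvDist (empDist xs ((c n).out xs)) PXY then iid PX n xs else 0)
      atTop (nhds 0)

/-- A good sequence of coordination codes for `P_{Y|X}` (specified via the joint `PXY`):
the rates converge to `I(X;Y)` and the empirical distribution converges to `PXY`
in variational distance, in probability. -/
def GoodCoord [Fintype X] [Fintype Y] [DecidableEq X] [DecidableEq Y]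
    (PX : X → ℝ) (PXY : X × Y → ℝ) (c : ∀ n, Code X Y n) : Prop :=
  Tendsto (fun n => (c n).rate) atTop (nhds (mutualInfo PXY)) ∧ TVInProb PX PXY c

end InformationDefs

section CoordinationLemmas

variable {α X Y : Type*}

/-- The total mass of a memoryless source on blocks is one. -/
theorem sum_iid_eq_one [Fintype X] {PX : X → ℝ} (hPX : IsPMF PX) (n : ℕ) :
    ∑ xs, iid PX n xs = 1 := by
  have h := Finset.prod_univ_sum (fun _ : Fin n => (Finset.univ : Finset X)) (fun _ x => PX x)
  rw [Fintype.piFinset_univ] at h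
  simp only [iid]
  rw [← h]
  simp [hPX.2]

/-- A pointwise difference is bounded by the variational distance. -/
theorem abs_sub_le_tvDist [Fintype α] (P Q : α → ℝ) (a : α) : |P a - Q a| ≤ tvDist P Q := by
  have h := Finset.le_sup' (fun A => |∑ a ∈ A, P a - ∑ a ∈ A, Q a|)
    (Finset.mem_powerset.2 (Finset.subset_univ ({a} : Finset α)))
  simpa [tvDist] using h

theorem IsPMF.le_one [Fintype α] {P : α → ℝ} (hP : IsPMF P) (a : α) : P a ≤ 1 :=
  hP.2 ▸ Finset.single_le_sum (fun b _ => hP.1 b) (Finset.mem_univ a)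

theorem empDist_nonneg [DecidableEq X] [DecidableEq Y] {n : ℕ}
    (xs : Fin n → X) (ys : Fin n → Y) (a : X × Y) : 0 ≤ empDist xs ys a := by
  unfold empDist
  positivity

theorem empDist_le_one [DecidableEq X] [DecidableEq Y] {n : ℕ}
    (xs : Fin n → X) (ys : Fin n → Y) (a : X × Y) : empDist xs ys a ≤ 1 := by
  unfold empDist
  refine div_le_one_of_le₀ ?_ (Nat.cast_nonneg n)
  exact_mod_cast (Finset.card_le_univ _).trans_eq (Fintype.card_fin n)

/-- A sum along a pair of sequences is `n` times its average under the empirical distribution. -/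
theorem sum_eq_mul_sum_empDist [Fintype X] [Fintype Y] [DecidableEq X] [DecidableEq Y] {n : ℕ}
    (hn : n ≠ 0) (xs : Fin n → X) (ys : Fin n → Y) (g : X × Y → ℝ) :
    ∑ i, g (xs i, ys i) = n * ∑ a, empDist xs ys a * g a := by
  have hn' : (n : ℝ) ≠ 0 := Nat.cast_ne_zero.2 hn
  rw [← Finset.sum_fiberwise Finset.univ (fun i => (xs i, ys i)) (fun i => g (xs i, ys i)),
    Finset.mul_sum]
  refine Finset.sum_congr rfl fun a _ => ?_
  rw [Finset.sum_congr rfl (g := fun _ => g a) (fun i hi => by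
    rw [(Finset.mem_filter.1 hi).2]), Finset.sum_const, nsmul_eq_mul, empDist, ← mul_assoc,
    mul_div_cancel₀ _ hn']
  congr 3
  ext i
  simp [Prod.ext_iff]

/-- If the empirical distribution converges in probability, then the expected empirical averages
of any function on the finite alphabet converge. -/
theorem TVInProb.tendsto_sum [Fintype X] [Fintype Y] [DecidableEq X] [DecidableEq Y]
    {PX : X → ℝ} (hPX : IsPMF PX) {PXY : X × Y → ℝ} (hPXY : IsPMF PXY)
    {c : ∀ n, Code X Y n} (hc : TVInProb PX PXY c) (g : X × Y → ℝ) :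
    Tendsto (fun n => ∑ xs, iid PX n xs * ∑ a, empDist xs ((c n).out xs) a * g a)
      atTop (nhds (∑ a, PXY a * g a)) := by
  set K : ℝ := ∑ a, |g a| with hK
  have hK0 : 0 ≤ K := Finset.sum_nonneg fun a _ => abs_nonneg _
  have hiid : ∀ n (xs : Fin n → X), 0 ≤ iid PX n xs := fun n xs =>
    Finset.prod_nonneg fun i _ => hPX.1 _
  rw [Metric.tendsto_atTop]
  intro δ hδ
  set ε : ℝ := δ / (2 * (K + 1)) with hε
  have hε0 : 0 < ε := by positivity
  obtain ⟨N, hN⟩ := Metric.tendsto_atTop.1 (hc ε hε0) ε hε0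
  refine ⟨N, fun n hn => ?_⟩
  have hprob := (abs_lt.1 (by simpa [Real.dist_eq] using hN n hn)).2
  have hdev : ∀ xs : Fin n → X, ∀ t : ℝ,
      (∀ a, |empDist xs ((c n).out xs) a - PXY a| ≤ t) →
      |∑ a, empDist xs ((c n).out xs) a * g a - ∑ a, PXY a * g a| ≤ K * t := by
    intro xs t ht
    rw [← Finset.sum_sub_distrib, hK, Finset.sum_mul]
    refine (Finset.abs_sum_le_sum_abs _ _).trans (Finset.sum_le_sum fun a _ => ?_)
    rw [← sub_mul, abs_mul, mul_comm]
    exact mul_le_mul_of_nonneg_left (ht a) (abs_nonneg _)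
  have hpoint : ∀ xs : Fin n → X,
      iid PX n xs * |∑ a, empDist xs ((c n).out xs) a * g a - ∑ a, PXY a * g a| ≤
        iid PX n xs * (K * ε) +
          K * (if ε < tvDist (empDist xs ((c n).out xs)) PXY then iid PX n xs else 0) := by
    intro xs
    split_ifs with h
    · have h1 := mul_le_mul_of_nonneg_left (hdev xs 1 fun a => abs_le.2
        ⟨by linarith [empDist_nonneg xs ((c n).out xs) a, hPXY.le_one a],
          by linarith [empDist_le_one xs ((c n).out xs) a, hPXY.1 a]⟩) (hiid n xs)
      have h2 : 0 ≤ iid PX n xs * (K * ε) := mul_nonneg (hiid n xs) (by positivity)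
      linarith
    · have h1 := mul_le_mul_of_nonneg_left (hdev xs ε fun a =>
        (abs_sub_le_tvDist _ _ a).trans (not_lt.1 h)) (hiid n xs)
      linarith
  have hsum : ∑ xs, iid PX n xs * ∑ a, empDist xs ((c n).out xs) a * g a - ∑ a, PXY a * g a =
      ∑ xs, iid PX n xs *
        (∑ a, empDist xs ((c n).out xs) a * g a - ∑ a, PXY a * g a) := by
    simp only [mul_sub, Finset.sum_sub_distrib]
    rw [← Finset.sum_mul, sum_iid_eq_one hPX, one_mul]
  rw [Real.dist_eq, hsum]
  calc _ ≤ ∑ xs, iid PX n xs *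
        |∑ a, empDist xs ((c n).out xs) a * g a - ∑ a, PXY a * g a| := by
        refine (Finset.abs_sum_le_sum_abs _ _).trans (Finset.sum_le_sum fun xs _ => ?_)
        rw [abs_mul, abs_of_nonneg (hiid n xs)]
    _ ≤ _ := Finset.sum_le_sum fun xs _ => hpoint xs
    _ ≤ K * ε + K * ε := by
        rw [Finset.sum_add_distrib, ← Finset.sum_mul, sum_iid_eq_one hPX, one_mul,
          ← Finset.mul_sum]
        gcongr
    _ < δ := by
        have : (K + 1) * ε + (K + 1) * ε = δ := by rw [hε]; field_simp; ring
        linarith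

theorem margY_inducedJoint [Fintype X] [DecidableEq Y] (PX : X → ℝ) {n : ℕ} (c : Code X Y n)
    (ys : Fin n → Y) :
    margY (inducedJoint PX c) ys = ∑ xs with c.out xs = ys, iid PX n xs := by
  simp only [margY, inducedJoint, iid, Finset.sum_filter, mul_ite, mul_one, mul_zero]
  exact Finset.sum_congr rfl fun xs _ => by simp only [eq_comm]

theorem margY_inducedJoint_out_pos [Fintype X] [DecidableEq Y] {PX : X → ℝ}
    (hPX : ∀ x, 0 < PX x) {n : ℕ} (c : Code X Y n) (xs : Fin n → X) :
    0 < margY (inducedJoint PX c) (c.out xs) := by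
  rw [margY_inducedJoint]
  exact Finset.sum_pos (fun _ _ => Finset.prod_pos fun _ _ => hPX _) ⟨xs, by simp⟩

/-- The entropy of the code output is at most the logarithm of the codebook size. -/
theorem neg_sum_log_margY_le_log_card [Fintype X] [DecidableEq Y] {PX : X → ℝ}
    (hPX : IsPMF PX) (hpos : ∀ x, 0 < PX x) {n : ℕ} (c : Code X Y n) :
    -∑ xs, iid PX n xs * Real.log (margY (inducedJoint PX c) (c.out xs)) ≤ Real.log c.M := by
  have hM : (0 : ℝ) < c.M := by exact_mod_cast c.hM
  have hq := margY_inducedJoint_out_pos hpos c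
  have hiid : ∀ xs, 0 ≤ iid PX n xs := fun xs => Finset.prod_nonneg fun i _ => hPX.1 _
  have hcount : ∑ xs, iid PX n xs / margY (inducedJoint PX c) (c.out xs) ≤ c.M := by
    have hmaps : ∀ xs ∈ (Finset.univ : Finset (Fin n → X)),
        c.out xs ∈ Finset.univ.image c.dec := fun xs _ =>
      Finset.mem_image_of_mem _ (Finset.mem_univ _)
    rw [← Finset.sum_fiberwise_of_maps_to hmaps]
    calc _ ≤ ∑ ys ∈ Finset.univ.image c.dec, (1 : ℝ) := by
          refine Finset.sum_le_sum fun ys _ => ?_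
          rw [Finset.sum_congr rfl
            (g := fun xs => iid PX n xs / margY (inducedJoint PX c) ys)
            (fun xs hxs => by rw [(Finset.mem_filter.1 hxs).2]), ← Finset.sum_div]
          rw [margY_inducedJoint]
          exact div_self_le_one _
      _ ≤ c.M := by
          rw [Finset.sum_const, nsmul_one]
          exact_mod_cast Finset.card_image_le.trans_eq (by simp)
  have hpoint : ∀ xs, -(iid PX n xs * Real.log (margY (inducedJoint PX c) (c.out xs))) ≤
      iid PX n xs * (Real.log c.M - 1) +
        iid PX n xs / margY (inducedJoint PX c) (c.out xs) / c.M := by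
    intro xs
    have h := Real.log_le_sub_one_of_pos
      (inv_pos.2 (mul_pos hM (hq xs)))
    rw [Real.log_inv, Real.log_mul hM.ne' (hq xs).ne'] at h
    have h' := mul_le_mul_of_nonneg_left h (hiid xs)
    have e : iid PX n xs / margY (inducedJoint PX c) (c.out xs) / c.M =
        iid PX n xs * (c.M * margY (inducedJoint PX c) (c.out xs))⁻¹ := by
      rw [div_div, mul_comm (c.M : ℝ), div_eq_mul_inv]
    rw [e]
    linarith
  rw [← Finset.sum_neg_distrib]
  refine (Finset.sum_le_sum fun xs _ => hpoint xs).trans ?_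
  rw [Finset.sum_add_distrib, ← Finset.sum_mul, sum_iid_eq_one hPX, ← Finset.sum_div]
  linarith [(div_le_one hM).2 hcount]

/-- The relative entropy between the code-induced joint distribution and its output marginal
followed by a memoryless channel `V`, bounded through the empirical average of `log (PX / V)`. -/
theorem relEnt_inducedJoint_div_le [Fintype X] [Fintype Y] [DecidableEq X] [DecidableEq Y]
    {PX : X → ℝ} (hPX : IsPMF PX) (hpos : ∀ x, 0 < PX x) {V : X → Y → ℝ}
    (hV : ∀ x y, 0 < V x y) {n : ℕ} (hn : n ≠ 0) (c : Code X Y n) :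
    relEnt (inducedJoint PX c) (fun p : (Fin n → X) × (Fin n → Y) =>
        margY (inducedJoint PX c) p.2 * ∏ i, V (p.1 i) (p.2 i)) / (n : ℝ≥0∞) ≤
      ENNReal.ofReal (c.rate + ∑ xs, iid PX n xs *
        ∑ a, empDist xs (c.out xs) a * Real.log (PX a.1 / V a.1 a.2)) := by
  have hn' : (0 : ℝ) < n := by exact_mod_cast Nat.pos_of_ne_zero hn
  have hq := margY_inducedJoint_out_pos hpos c
  have hprod : ∀ (xs : Fin n → X) (ys : Fin n → Y), 0 < ∏ i, V (xs i) (ys i) :=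
    fun xs ys => Finset.prod_pos fun i _ => hV _ _
  have hac : ∀ p : (Fin n → X) × (Fin n → Y),
      margY (inducedJoint PX c) p.2 * ∏ i, V (p.1 i) (p.2 i) = 0 → inducedJoint PX c p = 0 := by
    rintro ⟨xs, ys⟩ h
    by_cases hy : ys = c.out xs
    · subst hy
      exact absurd h (mul_pos (hq xs) (hprod _ _)).ne'
    · simp [inducedJoint, hy]
  rw [relEnt, if_pos hac, ← ENNReal.ofReal_natCast, ← ENNReal.ofReal_div_of_pos hn']
  refine ENNReal.ofReal_le_ofReal ?_
  have hterm : ∀ xs : Fin n → X,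
      ∑ ys, inducedJoint PX c (xs, ys) * Real.log (inducedJoint PX c (xs, ys) /
        (margY (inducedJoint PX c) ys * ∏ i, V (xs i) (ys i))) =
      -(iid PX n xs * Real.log (margY (inducedJoint PX c) (c.out xs))) +
        n * (iid PX n xs *
          ∑ a, empDist xs (c.out xs) a * Real.log (PX a.1 / V a.1 a.2)) := by
    intro xs
    have hp : 0 < iid PX n xs := Finset.prod_pos fun i _ => hpos _
    rw [Finset.sum_eq_single (c.out xs) (fun ys _ hy => by simp [inducedJoint, hy]) (by simp)]
    have e : inducedJoint PX c (xs, c.out xs) = iid PX n xs := by simp [inducedJoint, iid]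
    have hlog : Real.log (iid PX n xs) - Real.log (∏ i, V (xs i) (c.out xs i)) =
        n * ∑ a, empDist xs (c.out xs) a * Real.log (PX a.1 / V a.1 a.2) := by
      rw [← sum_eq_mul_sum_empDist hn xs (c.out xs) (fun a => Real.log (PX a.1 / V a.1 a.2)),
        iid, Real.log_prod (fun i _ => (hpos _).ne'), Real.log_prod (fun i _ => (hV _ _).ne'),
        ← Finset.sum_sub_distrib]
      exact Finset.sum_congr rfl fun i _ => (Real.log_div (hpos _).ne' (hV _ _).ne').symm
    rw [e, Real.log_div hp.ne' (mul_pos (hq xs) (hprod _ _)).ne',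
      Real.log_mul (hq xs).ne' (hprod _ _).ne', mul_left_comm, ← hlog]
    ring
  rw [Fintype.sum_prod_type, Finset.sum_congr rfl fun xs _ => hterm xs, Finset.sum_add_distrib,
    Finset.sum_neg_distrib, ← Finset.mul_sum, add_div, mul_div_cancel_left₀ _ hn'.ne', Code.rate]
  gcongr
  exact neg_sum_log_margY_le_log_card hPX hpos c

end CoordinationLemmas

/-- For `P_{XY} ∈ 𝒜` and any good sequence of coordination codes for `P_{Y|X}`, the
normalized relative entropy between the code-induced joint distribution `P_{XⁿYⁿ}` and
`P_{Yⁿ} Q_{Xⁿ|Yⁿ}` (its own `𝒴ⁿ`-marginal followed by the backward memoryless channel)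
vanishes. -/
theorem good_coordination_codes_backward_channel_relEnt
    {X Y : Type*} [Fintype X] [Fintype Y] [DecidableEq X] [DecidableEq Y]
    (PX : X → ℝ) (hPX : IsPMF PX) (hPXfull : ∀ x, 0 < PX x)
    (W : X → Y → ℝ) (hW : ∀ x, IsPMF (W x))
    (PXY : X × Y → ℝ) (hPXY : ∀ x y, PXY (x, y) = PX x * W x y)
    (hA : ∀ x y, 0 < condXY PXY x y)
    (c : ∀ n, Code X Y n) (hgood : GoodCoord PX PXY c) :
    Tendsto
      (fun n =>
        relEnt (inducedJoint PX (c n))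
          (fun p : (Fin n → X) × (Fin n → Y) =>
            margY (inducedJoint PX (c n)) p.2 * ∏ i, condXY PXY (p.1 i) (p.2 i)) /
          (n : ℝ≥0∞))
      atTop (nhds 0) := by
  have hmarg : ∀ x, margX PXY x = PX x := fun x => by
    simp only [margX, hPXY]
    rw [← Finset.mul_sum, (hW x).2, mul_one]
  have hPMF : IsPMF PXY :=
    ⟨fun a => hPXY a.1 a.2 ▸ mul_nonneg (hPX.1 _) ((hW _).1 _), by
      rw [Fintype.sum_prod_type]
      exact (Finset.sum_congr rfl fun x _ => hmarg x).trans hPX.2⟩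
  have hlim := hgood.1.add
    (hgood.2.tendsto_sum hPX hPMF fun a => Real.log (PX a.1 / condXY PXY a.1 a.2))
  have hzero : mutualInfo PXY + ∑ a, PXY a * Real.log (PX a.1 / condXY PXY a.1 a.2) = 0 := by
    rw [mutualInfo, Fintype.sum_prod_type, ← Finset.sum_add_distrib]
    refine Finset.sum_eq_zero fun x _ => ?_
    rw [← Finset.sum_add_distrib]
    refine Finset.sum_eq_zero fun y _ => ?_
    have e : PX x / condXY PXY x y = (PXY (x, y) / (margX PXY x * margY PXY y))⁻¹ := by
      rw [hmarg, condXY, inv_div, div_div_eq_mul_div]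
    rw [e, Real.log_inv]
    ring
  rw [hzero] at hlim
  have hub := ENNReal.tendsto_ofReal hlim
  rw [ENNReal.ofReal_zero] at hub
  refine tendsto_of_tendsto_of_tendsto_of_le_of_le' tendsto_const_nhds hub
    (Eventually.of_forall fun _ => zero_le) ?_
  filter_upwards [eventually_ne_atTop 0] with n hn
  exact relEnt_inducedJoint_div_le hPX hPXfull hA hn (c n)
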